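/- Let L ≥ 3 be an odd integer. The number of non-crossing partitions P of {1,…,L} such that for every j with 1 ≤ j ≤ (L−1)/2 the elements 2j−1 and 2j lie in different blocks of P equals the sum over i from 0 to (L−1)/2 of binom((L−1)/2, i) · A_{L−i}, where A_k denotes the number of non-crossing partitions of {1,…,k} having no block that contains two consecutive integers. (This is Theorem 2 of the paper for odd L_y: the count N_{P,hc,FF,L_y} of eigenvalues λ in the chromatic polynomial of free honeycomb-lattice strips equals Σ_{i=0}^{(L_y−1)/2} M_{L_y−1−i} binom((L_y−1)/2, i), since A_k is the Motzkin number M_{k−1}.) -/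

import Mathlib

open Finset

/-- A partition `P` of `{1,…,L}` (modeled as `Fin L`) is non-crossing if there are no
indices `a < b < c < d` with `a, c` in one block of `P` and `b, d` in a different block. -/
def NonCrossing {L : ℕ} (P : Finpartition (Finset.univ : Finset (Fin L))) : Prop :=
  ¬ ∃ a b c d : Fin L, a < b ∧ b < c ∧ c < d ∧
      ∃ B₁ ∈ P.parts, ∃ B₂ ∈ P.parts, B₁ ≠ B₂ ∧ a ∈ B₁ ∧ c ∈ B₁ ∧ b ∈ B₂ ∧ d ∈ B₂

/-- A partition has no block containing two consecutive integers `i, i+1`. -/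
def NoConsecutive {k : ℕ} (P : Finpartition (Finset.univ : Finset (Fin k))) : Prop :=
  ¬ ∃ i j : Fin k, (j : ℕ) = (i : ℕ) + 1 ∧ ∃ B ∈ P.parts, i ∈ B ∧ j ∈ B

/-- `A k` is the number of non-crossing partitions of `{1,…,k}` having no block that
contains two consecutive integers (the Motzkin number `M_{k−1}`). -/
noncomputable def A (k : ℕ) : ℕ :=
  {P : Finpartition (Finset.univ : Finset (Fin k)) | NonCrossing P ∧ NoConsecutive P}.ncard

/-- The equivalence relation on `Fin n` whose classes are the blocks of a finite partition. -/
def Finpartition.toSetoid {n : ℕ} (P : Finpartition (univ : Finset (Fin n))) :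
    Setoid (Fin n) where
  r a b := ∃ B ∈ P.parts, a ∈ B ∧ b ∈ B
  iseqv :=
    { refl := fun a => ⟨P.part a, P.part_mem.2 (mem_univ a), P.mem_part (mem_univ a),
        P.mem_part (mem_univ a)⟩
      symm := fun ⟨B, hB, ha, hb⟩ => ⟨B, hB, hb, ha⟩
      trans := fun ⟨B, hB, ha, hb⟩ ⟨C, hC, hb', hc⟩ =>
        ⟨B, hB, ha, by rwa [P.eq_of_mem_parts hB hC hb hb']⟩ }

theorem Finpartition.toSetoid_rel {n : ℕ} (P : Finpartition (univ : Finset (Fin n)))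
    (a b : Fin n) : P.toSetoid a b ↔ ∃ B ∈ P.parts, a ∈ B ∧ b ∈ B :=
  Iff.rfl

theorem Finpartition.toSetoid_bijective (n : ℕ) :
    Function.Bijective
      (Finpartition.toSetoid : Finpartition (univ : Finset (Fin n)) → Setoid (Fin n)) := by
  constructor
  · have key : ∀ P Q : Finpartition (univ : Finset (Fin n)), P.toSetoid = Q.toSetoid →
        ∀ B ∈ P.parts, B ∈ Q.parts := by
      intro P Q h B hB
      obtain ⟨a, ha⟩ := P.nonempty_of_mem_parts hB
      have hpart : Q.part a = B := by
        ext b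
        rw [← P.part_eq_of_mem hB ha, Q.mem_part_iff_exists, P.mem_part_iff_exists,
          ← P.toSetoid_rel, ← Q.toSetoid_rel, h]
      exact hpart ▸ Q.part_mem.2 (mem_univ a)
    intro P Q h
    ext B
    exact ⟨key P Q h B, key Q P h.symm B⟩
  · classical
    intro s
    refine ⟨Finpartition.ofSetoid s, ?_⟩
    ext a b
    rw [toSetoid_rel, ← Finpartition.mem_part_iff_exists,
      Finpartition.mem_part_ofSetoid_iff_rel, Setoid.comm']

/-- An equivalence relation on `Fin n` is non-crossing if its classes are. -/
def Setoid.NonCrossing {n : ℕ} (r : Setoid (Fin n)) : Prop :=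
  ∀ a b c d : Fin n, a < b → b < c → c < d → r a c → r b d → r a b

theorem nonCrossing_iff_toSetoid {n : ℕ} (P : Finpartition (univ : Finset (Fin n))) :
    NonCrossing P ↔ P.toSetoid.NonCrossing := by
  constructor
  · rintro h a b c d hab hbc hcd ⟨B, hB, ha, hc⟩ ⟨C, hC, hb, hd⟩
    by_cases hBC : B = C
    · exact ⟨B, hB, ha, hBC ▸ hb⟩
    · exact (h ⟨a, b, c, d, hab, hbc, hcd, B, hB, C, hC, hBC, ha, hc, hb, hd⟩).elim
  · rintro h ⟨a, b, c, d, hab, hbc, hcd, B, hB, C, hC, hBC, ha, hc, hb, hd⟩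
    obtain ⟨E, hE, ha', hb'⟩ := h a b c d hab hbc hcd ⟨B, hB, ha, hc⟩ ⟨C, hC, hb, hd⟩
    exact hBC ((P.eq_of_mem_parts hB hE ha ha').trans (P.eq_of_mem_parts hE hC hb' hb))

theorem Setoid.NonCrossing.comap_of_monotone {m n : ℕ} {r : Setoid (Fin n)}
    (hr : r.NonCrossing) {f : Fin m → Fin n} (hf : Monotone f) :
    (Setoid.comap f r).NonCrossing := by
  intro a b c d hab hbc hcd hac hbd
  simp only [Setoid.comap_rel] at *
  rcases (hf hab.le).eq_or_lt with h1 | h1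
  · rw [h1]
  rcases (hf hbc.le).eq_or_lt with h2 | h2
  · rwa [h2]
  rcases (hf hcd.le).eq_or_lt with h3 | h3
  · exact r.trans' hac (h3 ▸ r.symm' hbd)
  exact hr _ _ _ _ h1 h2 h3 hac hbd

/-- Non-crossing equivalence relations on `Fin n` in which `i` and `i + 1` may be related only
when `i ∈ F`. -/
def separatedNonCrossing (n : ℕ) (F : Finset ℕ) : Set (Setoid (Fin n)) :=
  {r | r.NonCrossing ∧ ∀ i j : Fin n, (j : ℕ) = i + 1 → (i : ℕ) ∉ F → ¬ r i j}

theorem ncard_setOf_nonCrossing (n : ℕ) (F : Finset ℕ)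
    (p : Finpartition (univ : Finset (Fin n)) → Prop)
    (hp : ∀ P, p P ↔ ∀ i j : Fin n, (j : ℕ) = i + 1 → (i : ℕ) ∉ F →
      ¬ ∃ B ∈ P.parts, i ∈ B ∧ j ∈ B) :
    {P | NonCrossing P ∧ p P}.ncard = (separatedNonCrossing n F).ncard := by
  have hpre : {P | NonCrossing P ∧ p P} =
      Finpartition.toSetoid ⁻¹' separatedNonCrossing n F := by
    ext P
    simp only [Set.mem_ofPred_eq, hp, nonCrossing_iff_toSetoid, separatedNonCrossing,
      Set.mem_preimage, Finpartition.toSetoid_rel]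
  have hbij := Finpartition.toSetoid_bijective n
  rw [hpre, Set.ncard_preimage_of_injective_subset_range hbij.1]
  simp [hbij.2.range_eq]

theorem A_eq_ncard_separatedNonCrossing (k : ℕ) :
    A k = (separatedNonCrossing k ∅).ncard := by
  refine ncard_setOf_nonCrossing k ∅ _ fun P => ?_
  simp only [NoConsecutive, notMem_empty, not_false_eq_true, forall_const]
  push Not
  rfl

/-- The non-crossing relations with `e` and `e + 1` related correspond, by contracting this pair,
to non-crossing relations on a set with one element less. -/
theorem ncard_separatedNonCrossing_joined {n e : ℕ} (F : Finset ℕ) (he : e < n)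
    (hF : ∀ x ∈ F, x < e) :
    {r ∈ separatedNonCrossing (n + 1) (insert e F) |
      r ⟨e, by lia⟩ ⟨e + 1, by lia⟩}.ncard = (separatedNonCrossing n F).ncard := by
  let c : Fin (n + 1) → Fin n := fun i =>
    ⟨if (i : ℕ) ≤ e then i else i - 1, by have := i.2; split_ifs <;> lia⟩
  let s : Fin n → Fin (n + 1) := fun i =>
    ⟨if (i : ℕ) ≤ e then i else i + 1, by have := i.2; split_ifs <;> lia⟩
  have hc_val : ∀ i, (c i : ℕ) = if (i : ℕ) ≤ e then (i : ℕ) else i - 1 := fun _ => rfl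
  have hs_val : ∀ i, (s i : ℕ) = if (i : ℕ) ≤ e then (i : ℕ) else i + 1 := fun _ => rfl
  have hc : Monotone c := by
    intro i j hij
    have : (i : ℕ) ≤ j := hij
    rw [Fin.le_def, hc_val, hc_val]
    split_ifs <;> lia
  have hs : Monotone s := by
    intro i j hij
    have : (i : ℕ) ≤ j := hij
    rw [Fin.le_def, hs_val, hs_val]
    split_ifs <;> lia
  have hcs : ∀ i, c (s i) = i := by
    intro i
    apply Fin.ext
    rw [hc_val, hs_val]
    split_ifs <;> lia
  have hsc : ∀ i : Fin (n + 1), (i : ℕ) ≠ e + 1 → s (c i) = i := by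
    intro i hi
    apply Fin.ext
    rw [hs_val, hc_val]
    split_ifs <;> lia
  have hinj : Function.Injective (Setoid.comap c) := by
    intro r t h
    ext a b
    have := congrArg (fun q : Setoid (Fin (n + 1)) => q (s a) (s b)) h
    simpa [Setoid.comap_rel, hcs] using this
  rw [← Set.ncard_image_of_injective _ hinj]
  congr 1
  ext r
  constructor
  · rintro ⟨⟨hnc, hsep⟩, hjoin⟩
    have hrel : ∀ i, r (s (c i)) i := by
      intro i
      by_cases hi : (i : ℕ) = e + 1
      · have h1 : s (c i) = ⟨e, by lia⟩ := by
          apply Fin.ext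
          rw [hs_val, hc_val]
          simp [hi]
        have h2 : i = ⟨e + 1, by lia⟩ := Fin.ext hi
        rw [h1, h2]
        exact hjoin
      · rw [hsc i hi]
    refine ⟨Setoid.comap s r, ⟨hnc.comap_of_monotone hs, ?_⟩, ?_⟩
    · intro i j hij hi hr
      rw [Setoid.comap_rel] at hr
      by_cases hie : (i : ℕ) = e
      · have h1 : s i = ⟨e, by lia⟩ := by apply Fin.ext; rw [hs_val]; simp [hie]
        rw [h1] at hr
        refine hsep ⟨e + 1, by lia⟩ (s j) ?_ ?_ (r.trans' (r.symm' hjoin) hr)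
        · rw [hs_val]; simp [hij, hie]
        · intro h
          rcases mem_insert.1 h with h | h
          · simp at h
          · have := hF _ h
            simp at this
      · refine hsep (s i) (s j) ?_ ?_ hr
        · rw [hs_val, hs_val]
          split_ifs <;> lia
        · rw [hs_val, mem_insert]
          rintro (h | h)
          · split_ifs at h <;> lia
          · split_ifs at h with h'
            · exact hi h
            · have := hF _ h
              lia
    · ext a b
      rw [Setoid.comap_rel, Setoid.comap_rel]
      exact ⟨fun h => r.trans' (r.symm' (hrel a)) (r.trans' h (hrel b)),
        fun h => r.trans' (hrel a) (r.trans' h (r.symm' (hrel b)))⟩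
  · rintro ⟨t, ⟨hnc, hsep⟩, rfl⟩
    refine ⟨⟨hnc.comap_of_monotone hc, ?_⟩, ?_⟩
    · intro i j hij hi
      rw [mem_insert, not_or] at hi
      refine hsep (c i) (c j) ?_ ?_
      · rw [hc_val, hc_val]
        split_ifs <;> lia
      · rw [hc_val]
        split_ifs with h
        · exact hi.2
        · intro h'
          have := hF _ h'
          lia
    · rw [Setoid.comap_rel]
      have : c ⟨e, by lia⟩ = c ⟨e + 1, by lia⟩ := by
        apply Fin.ext
        rw [hc_val, hc_val]
        simp
      rw [this]

theorem ncard_separatedNonCrossing_insert {n e : ℕ} (F : Finset ℕ) (he : e < n)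
    (hF : ∀ x ∈ F, x < e) :
    (separatedNonCrossing (n + 1) (insert e F)).ncard =
      (separatedNonCrossing (n + 1) F).ncard + (separatedNonCrossing n F).ncard := by
  have hfin : Finite (Setoid (Fin (n + 1))) :=
    Finite.of_surjective _ (Finpartition.toSetoid_bijective (n + 1)).2
  rw [← ncard_separatedNonCrossing_joined F he hF, ← Set.ncard_union_eq]
  · congr 1
    ext r
    constructor
    · rintro ⟨hnc, hsep⟩
      by_cases h : r ⟨e, by lia⟩ ⟨e + 1, by lia⟩
      · exact Or.inr ⟨⟨hnc, hsep⟩, h⟩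
      · refine Or.inl ⟨hnc, fun i j hij hi hr => ?_⟩
        by_cases hie : (i : ℕ) = e
        · obtain rfl : i = ⟨e, by lia⟩ := Fin.ext hie
          obtain rfl : j = ⟨e + 1, by lia⟩ := Fin.ext hij
          exact h hr
        · exact hsep i j hij (by simp [hie, hi]) hr
    · rintro (⟨hnc, hsep⟩ | ⟨h, -⟩)
      · exact ⟨hnc, fun i j hij hi => hsep i j hij fun h => hi (mem_insert_of_mem h)⟩
      · exact h
  · rw [Set.disjoint_left]
    rintro r ⟨-, hsep⟩ ⟨-, hr⟩
    exact hsep _ _ rfl (fun h => (hF _ h).false) hr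

theorem ncard_separatedNonCrossing (F : Finset ℕ) :
    ∀ n : ℕ, (∀ x ∈ F, x + 1 < n) →
      (separatedNonCrossing n F).ncard =
        ∑ i ∈ range (#F + 1), (#F).choose i * A (n - i) := by
  induction F using Finset.induction_on_max with
  | empty => intro n _; simp [A_eq_ncard_separatedNonCrossing]
  | insert e F hF ih =>
    intro n hn
    have hen := hn e (mem_insert_self e F)
    obtain ⟨n, rfl⟩ : ∃ m, n = m + 1 := ⟨n - 1, by lia⟩
    rw [ncard_separatedNonCrossing_insert F (by lia) hF,
      ih _ fun x hx => hn x (mem_insert_of_mem hx),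
      ih n fun x hx => by have := hF x hx; lia,
      card_insert_of_notMem fun h => (hF e h).false]
    have h := sum_choose_succ_mul (R := ℕ) (fun i _ => A (n + 1 - i)) #F
    simp only [Nat.cast_id, Nat.add_sub_add_right] at h
    lia

/-- For odd `L ≥ 3`, the number of non-crossing partitions `P` of `{1,…,L}` such that for
every `1 ≤ j ≤ (L−1)/2` the elements `2j−1` and `2j` lie in different blocks of `P` equals
`Σ_{i=0}^{(L−1)/2} binom((L−1)/2, i) · A_{L−i}`.  (Elements of `{1,…,L}` are modeled by
`Fin L` with `m ∈ {1,…,L}` corresponding to the element of `Fin L` with value `m−1`.) -/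
theorem noncrossing_missing_edges_count (L : ℕ) (hL : 3 ≤ L) (hodd : Odd L) :
    {P : Finpartition (Finset.univ : Finset (Fin L)) | NonCrossing P ∧
        ∀ j : ℕ, 1 ≤ j → j ≤ (L - 1) / 2 →
          ∀ a b : Fin L, (a : ℕ) = 2 * j - 2 → (b : ℕ) = 2 * j - 1 →
            ¬ ∃ B ∈ P.parts, a ∈ B ∧ b ∈ B}.ncard
      = ∑ i ∈ Finset.range ((L - 1) / 2 + 1), Nat.choose ((L - 1) / 2) i * A (L - i) := by
  obtain ⟨m, rfl⟩ := hodd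
  have hm : (2 * m + 1 - 1) / 2 = m := by lia
  rw [hm]
  have hinj : Function.Injective fun i : ℕ => 2 * i + 1 := fun a b h => by
    simp only at h
    lia
  have hcard : #((range m).image fun i => 2 * i + 1) = m := by
    rw [card_image_of_injective _ hinj, card_range]
  have h := ncard_separatedNonCrossing ((range m).image fun i => 2 * i + 1) (2 * m + 1) (by
    intro x hx
    obtain ⟨i, hi, rfl⟩ := mem_image.1 hx
    have := mem_range.1 hi
    lia)
  rw [hcard] at h
  rw [← h]
  refine ncard_setOf_nonCrossing _ _ _ fun P => ⟨fun hP i j hij hi => ?_, fun hP j h1 h2 a b ha hb =>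
    hP a b (by lia) fun hmem => ?_⟩
  · have hj := j.2
    have hodd : (i : ℕ) % 2 = 0 := by
      by_contra hne
      exact hi (mem_image.2 ⟨i / 2, mem_range.2 (by lia), by lia⟩)
    exact hP (i / 2 + 1) (by lia) (by lia) i j (by lia) (by lia)
  · obtain ⟨k, -, hk⟩ := mem_image.1 hmem
    lia
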